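/- Let ℍⁿ, n ≥ 2, be a Heisenberg group with a left-invariant homogeneous distance d, let 𝕎 and 𝕃 be the complementary subgroups below, let φ̃: 𝕎 → 𝕃 be intrinsic L-Lipschitz, and let Γ = graph(φ̃). Then the restriction of d to Γ is bi-Lipschitz equivalent to the intrinsic length distance d^Γ on Γ, i.e. there is a constant C ≥ 1 with (1/C)·d(x,y) ≤ d^Γ(x,y) ≤ C·d(x,y) for all x, y ∈ Γ. -/

import Mathlib

open Metric MeasureTheory
open scoped ENNReal Topology

namespace Heis

/-- Points of the `n`-th Heisenberg group `ℍⁿ` in exponential coordinates: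
`((x₁, …, x_n), (x_{n+1}, …, x_{2n}), y₁)`. -/
abbrev Pt (n : ℕ) := (Fin n → ℝ) × (Fin n → ℝ) × ℝ

variable {n : ℕ}

/-- The Heisenberg group operation (the step-2 group with `[X_j, X_{n+j}] = Y₁` for
`j = 1, …, n` and all other brackets of frame vectors zero):
`(a, b, c)·(a', b', c') = (a + a', b + b', c + c' + ½ Σ_j (b'_j a_j − a'_j b_j))`. -/
noncomputable def mul (p q : Pt n) : Pt n :=
  (p.1 + q.1, p.2.1 + q.2.1,
    p.2.2 + q.2.2 + (1 / 2) * ∑ j, (q.2.1 j * p.1 j - q.1 j * p.2.1 j))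

/-- Inversion (negation, in exponential coordinates). -/
def inv (p : Pt n) : Pt n := (-p.1, -p.2.1, -p.2.2)

/-- The intrinsic dilations `δ_λ(x, y) = (λx, λ²y)`. -/
def dil (lam : ℝ) (p : Pt n) : Pt n := (lam • p.1, lam • p.2.1, lam ^ 2 * p.2.2)

/-- `d` is a left-invariant homogeneous distance on `ℍⁿ`. -/
structure IsLIHomDist (d : Pt n → Pt n → ℝ) : Prop where
  self : ∀ p, d p p = 0
  eq_of_dist_eq_zero : ∀ p q, d p q = 0 → p = q
  symm : ∀ p q, d p q = d q p
  triangle : ∀ p q r, d p r ≤ d p q + d q r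
  left_invariant : ∀ z p q, d (mul z p) (mul z q) = d p q
  homogeneous : ∀ lam : ℝ, 0 < lam → ∀ p q, d (dil lam p) (dil lam q) = lam * d p q

/-- The projection onto the horizontal subgroup `𝕃 = {(x₁, 0, …, 0)}`. -/
def projL [NeZero n] (p : Pt n) : Pt n := ((Pi.single 0 (p.1 0) : Fin n → ℝ), 0, 0)

/-- The projection onto the complementary vertical subgroup `𝕎 = {x₁ = 0}`. -/
noncomputable def projW [NeZero n] (p : Pt n) : Pt n := mul p (inv (projL p))

/-- The graph point `w · φ̃(w)` over `w ∈ 𝕎`, where `φ̃ : 𝕎 → 𝕃` has scalar component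
`φv`. -/
noncomputable def graphPt [NeZero n] (φv : Pt n → ℝ) (w : Pt n) : Pt n :=
  mul w ((Pi.single 0 (φv w) : Fin n → ℝ), 0, 0)

/-- `φ̃ : 𝕎 → 𝕃` (with scalar component `φv`) is intrinsic `L`-Lipschitz: for every point
`p` of its graph, the cone `C_{𝕎,𝕃}(p, 1/L) = p · {q : d(q_𝕎, e) ≤ (1/L) d(q_𝕃, e)}`
meets the graph only at `p`. -/
def IsIntrinsicLip [NeZero n] (d : Pt n → Pt n → ℝ) (L : ℝ) (φv : Pt n → ℝ) : Prop :=
  ∀ w w' : Pt n, w.1 0 = 0 → w'.1 0 = 0 →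
    d (projW (mul (inv (graphPt φv w)) (graphPt φv w'))) 0
        ≤ (1 / L) * d (projL (mul (inv (graphPt φv w)) (graphPt φv w'))) 0 →
    w = w'

/-- The intrinsic graph `Γ = graph(φ̃) = {w · φ̃(w) : w ∈ 𝕎}`. -/
def graphSet [NeZero n] (φv : Pt n → ℝ) : Set (Pt n) :=
  {p | ∃ w : Pt n, w.1 0 = 0 ∧ p = graphPt φv w}

/-- `γ : [t₀, t₁] → ℍⁿ` is an (absolutely continuous) horizontal curve, with controls `c`
(the coefficients of `γ'` in the horizontal frame `X₁, …, X_{2n}`). -/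
structure IsHCurve (γ : ℝ → Pt n) (c : ℝ → (Fin n → ℝ) × (Fin n → ℝ)) (t₀ t₁ : ℝ) :
    Prop where
  le : t₀ ≤ t₁
  integrable : IntegrableOn c (Set.Icc t₀ t₁)
  fst : ∀ t ∈ Set.Icc t₀ t₁, ∀ j, (γ t).1 j = (γ t₀).1 j + ∫ s in t₀..t, (c s).1 j
  snd : ∀ t ∈ Set.Icc t₀ t₁, ∀ j, (γ t).2.1 j = (γ t₀).2.1 j + ∫ s in t₀..t, (c s).2 j
  vert : ∀ t ∈ Set.Icc t₀ t₁, (γ t).2.2 = (γ t₀).2.2 +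
    ∫ s in t₀..t, (1 / 2) * ∑ j, ((c s).2 j * (γ s).1 j - (c s).1 j * (γ s).2.1 j)

/-- The length of a curve with respect to the distance `d`: the supremum over partitions
`t₀ = σ 0 ≤ σ 1 ≤ ⋯ ≤ σ N = t₁` of `Σᵢ d(γ(σ i), γ(σ (i+1)))`. -/
noncomputable def pathLength (d : Pt n → Pt n → ℝ) (γ : ℝ → Pt n) (t₀ t₁ : ℝ) : ℝ≥0∞ :=
  ⨆ (N : ℕ) (σ : ℕ → ℝ) (_ : Monotone σ ∧ σ 0 = t₀ ∧ σ N = t₁),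
    ENNReal.ofReal (∑ i ∈ Finset.range N, d (γ (σ i)) (γ (σ (i + 1))))

/-- The intrinsic length distance `d^Γ` on `Γ`: the infimum of the `d`-lengths of
horizontal curves contained in `Γ` joining the two points. -/
noncomputable def dGamma (d : Pt n → Pt n → ℝ) (Γ : Set (Pt n)) (x y : Pt n) : ℝ≥0∞ :=
  ⨅ (γ : ℝ → Pt n)
    (_ : (∃ c, IsHCurve γ c 0 1) ∧ (∀ t ∈ Set.Icc (0 : ℝ) 1, γ t ∈ Γ) ∧
      γ 0 = x ∧ γ 1 = y),
    pathLength d γ 0 1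

/-- The element `exp(a X₁)` of the horizontal subgroup. -/
def ell [NeZero n] (a : ℝ) : Pt n := ((Pi.single 0 a : Fin n → ℝ), 0, 0)

theorem mul_assoc' (p q r : Pt n) : mul (mul p q) r = mul p (mul q r) := by
  refine Prod.ext ?_ (Prod.ext ?_ ?_)
  · simp [mul, add_assoc]
  · simp [mul, add_assoc]
  · simp only [mul, Pi.add_apply, mul_add, add_mul, Finset.sum_add_distrib,
      Finset.sum_sub_distrib]
    ring

theorem inv_mul (p : Pt n) : mul (inv p) p = 0 := by
  refine Prod.ext ?_ (Prod.ext ?_ ?_)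
  · simp [mul, inv]
  · simp [mul, inv]
  · simp only [mul, inv, Pi.neg_apply, mul_neg, Finset.sum_sub_distrib,
      Finset.sum_neg_distrib, Prod.snd_zero]
    have : ∀ j, p.2.1 j * p.1 j = p.1 j * p.2.1 j := fun j => mul_comm _ _
    simp [this]

theorem inv_inv' (p : Pt n) : inv (inv p) = p := by
  simp [inv]

theorem mul_inv' (p : Pt n) : mul p (inv p) = 0 := by
  have := inv_mul (inv p)
  rwa [inv_inv'] at this

theorem mul_zero' (p : Pt n) : mul p 0 = p := by
  simp [mul]

theorem zero_mul' (p : Pt n) : mul 0 p = p := by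
  simp [mul]

theorem inv_mul_cancel (p q : Pt n) : mul (inv p) (mul p q) = q := by
  rw [← mul_assoc', inv_mul, zero_mul']

theorem mul_inv_cancel (p q : Pt n) : mul p (mul (inv p) q) = q := by
  rw [← mul_assoc', mul_inv', zero_mul']

theorem ell_zero [NeZero n] : (ell 0 : Pt n) = 0 := by
  simp [ell]

theorem inv_ell [NeZero n] (a : ℝ) : inv (ell a : Pt n) = ell (-a) := by
  simp [inv, ell, Pi.single_neg]

theorem ell_mul_ell [NeZero n] (a b : ℝ) : mul (ell a : Pt n) (ell b) = ell (a + b) := by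
  simp [mul, ell, Pi.single_add]

theorem ell_comm [NeZero n] (a : ℝ) (h : Pt n) (hh : h.2.1 0 = 0) :
    mul (ell a) h = mul h (ell a) := by
  refine Prod.ext ?_ (Prod.ext ?_ ?_)
  · simp [mul, ell, add_comm]
  · simp [mul, ell]
  · have h1 : ∑ j, h.2.1 j * (Pi.single 0 a : Fin n → ℝ) j = 0 := by
      rw [Finset.sum_eq_single 0]
      · simp [hh]
      · intro b _ hb; simp [hb]
      · simp
    have h2 : ∑ j, (Pi.single 0 a : Fin n → ℝ) j * h.2.1 j = 0 := by
      rw [← h1]; exact Finset.sum_congr rfl fun j _ => mul_comm _ _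
    simp [mul, ell, h1, h2]

section dist
variable {d : Pt n → Pt n → ℝ}

theorem IsLIHomDist.nonneg (hd : IsLIHomDist d) (p q : Pt n) : 0 ≤ d p q := by
  have h1 := hd.triangle p q p
  rw [hd.self, hd.symm q p] at h1
  linarith

theorem IsLIHomDist.eq_norm (hd : IsLIHomDist d) (p q : Pt n) :
    d p q = d (mul (inv p) q) 0 := by
  rw [← hd.left_invariant (inv p) p q, inv_mul, hd.symm]

theorem IsLIHomDist.mul_norm (hd : IsLIHomDist d) (p q : Pt n) : d p (mul p q) = d q 0 := by
  rw [hd.eq_norm, inv_mul_cancel]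

theorem IsLIHomDist.norm_mul_le (hd : IsLIHomDist d) (p q : Pt n) :
    d (mul p q) 0 ≤ d p 0 + d q 0 := by
  have h := hd.triangle (mul p q) p 0
  rw [hd.symm (mul p q) p, hd.mul_norm] at h
  linarith

theorem IsLIHomDist.norm_inv (hd : IsLIHomDist d) (p : Pt n) : d (inv p) 0 = d p 0 := by
  rw [← hd.left_invariant p (inv p) 0, mul_inv', mul_zero', hd.symm]

theorem IsLIHomDist.norm_dil (hd : IsLIHomDist d) {r : ℝ} (hr : 0 < r) (p : Pt n) :
    d (dil r p) 0 = r * d p 0 := by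
  rw [← hd.homogeneous r hr p 0]
  congr 1
  refine Prod.ext ?_ (Prod.ext ?_ ?_) <;> simp [dil]

theorem norm_hor_smul (hd : IsLIHomDist d) (r : ℝ) (a b : Fin n → ℝ) :
    d (r • a, r • b, 0) 0 = |r| * d (a, b, 0) 0 := by
  rcases lt_trichotomy r 0 with h | h | h
  · rw [abs_of_neg h, ← hd.norm_dil (by linarith : 0 < -r), ← hd.norm_inv]
    simp [inv, dil]
  · subst h
    simp only [zero_smul, abs_zero, zero_mul]
    exact hd.self 0
  · rw [abs_of_pos h, ← hd.norm_dil h]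
    simp [dil]

theorem norm_vert (hd : IsLIHomDist d) (c : ℝ) :
    d (0, 0, c) 0 = Real.sqrt |c| * d (0, 0, 1) 0 := by
  rcases lt_trichotomy c 0 with h | h | h
  · have h1 : 0 < Real.sqrt |c| := Real.sqrt_pos.2 (abs_pos.2 h.ne)
    rw [← hd.norm_dil h1, ← hd.norm_inv]
    rw [dil, Real.sq_sqrt (abs_nonneg c), abs_of_neg h]
    simp [inv]
  · subst h
    simp only [abs_zero, Real.sqrt_zero, zero_mul]
    exact hd.self 0
  · have h1 : 0 < Real.sqrt |c| := Real.sqrt_pos.2 (abs_pos.2 h.ne')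
    rw [← hd.norm_dil h1]
    rw [dil, Real.sq_sqrt (abs_nonneg c), abs_of_pos h]
    simp

/-- An explicit homogeneous quasi-norm. -/
noncomputable def hom (p : Pt n) : ℝ := ‖p.1‖ + ‖p.2.1‖ + Real.sqrt |p.2.2|

theorem hom_nonneg (p : Pt n) : 0 ≤ hom p := by unfold hom; positivity

theorem hom_zero : hom (0 : Pt n) = 0 := by simp [hom]

theorem hom_eq_zero {p : Pt n} (h : hom p = 0) : p = 0 := by
  unfold hom at h
  have h1 := norm_nonneg p.1
  have h2 := norm_nonneg p.2.1
  have h3 := Real.sqrt_nonneg |p.2.2|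
  refine Prod.ext ?_ (Prod.ext ?_ ?_)
  · exact norm_eq_zero.1 (by linarith)
  · exact norm_eq_zero.1 (by linarith)
  · have : Real.sqrt |p.2.2| = 0 := by linarith
    rw [Real.sqrt_eq_zero (abs_nonneg _)] at this
    simpa using this

theorem hom_dil {r : ℝ} (hr : 0 < r) (p : Pt n) : hom (dil r p) = r * hom p := by
  simp only [hom, dil, norm_smul, Real.norm_eq_abs, abs_mul, abs_pow, abs_of_pos hr]
  rw [Real.sqrt_mul (by positivity), Real.sqrt_sq hr.le]
  ring

theorem hom_continuous : Continuous (hom : Pt n → ℝ) := by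
  unfold hom; fun_prop

theorem mul_continuous : Continuous (fun z : Pt n × Pt n => mul z.1 z.2) := by
  unfold mul; fun_prop

theorem inv_continuous : Continuous (inv : Pt n → Pt n) := by
  unfold inv; fun_prop

theorem exists_upper (hd : IsLIHomDist d) : ∃ C : ℝ, 0 < C ∧ ∀ p : Pt n, d p 0 ≤ C * hom p := by
  have ha : ∃ A : ℝ, 0 ≤ A ∧ ∀ a : Fin n → ℝ, d (a, 0, 0) 0 ≤ A * ‖a‖ := by
    refine ⟨∑ i, d (Pi.single i 1, 0, 0) 0, Finset.sum_nonneg fun i _ => hd.nonneg _ _, ?_⟩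
    intro a
    have h1 := Finset.le_sum_of_subadditive (fun a : Fin n → ℝ => d (a, 0, 0) 0) (hd.self 0).le
      (fun x y => by
        have := hd.norm_mul_le (x, 0, 0) (y, 0, 0)
        simpa [mul] using this) Finset.univ (fun i => Pi.single i (a i))
    rw [Finset.univ_sum_single, ] at h1
    refine h1.trans ?_
    rw [Finset.sum_mul]
    refine Finset.sum_le_sum fun i _ => ?_
    have h2 := norm_hor_smul hd (a i) (Pi.single i 1) 0
    rw [smul_zero, ← Pi.single_smul, smul_eq_mul, mul_one] at h2
    rw [h2, mul_comm]
    exact mul_le_mul_of_nonneg_left (norm_le_pi_norm a i) (hd.nonneg _ _)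
  have hb : ∃ A : ℝ, 0 ≤ A ∧ ∀ a : Fin n → ℝ, d (0, a, 0) 0 ≤ A * ‖a‖ := by
    refine ⟨∑ i, d (0, Pi.single i 1, 0) 0, Finset.sum_nonneg fun i _ => hd.nonneg _ _, ?_⟩
    intro a
    have h1 := Finset.le_sum_of_subadditive (fun a : Fin n → ℝ => d (0, a, 0) 0) (hd.self 0).le
      (fun x y => by
        have := hd.norm_mul_le (0, x, 0) (0, y, 0)
        simpa [mul] using this) Finset.univ (fun i => Pi.single i (a i))
    rw [Finset.univ_sum_single, ] at h1
    refine h1.trans ?_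
    rw [Finset.sum_mul]
    refine Finset.sum_le_sum fun i _ => ?_
    have h2 := norm_hor_smul hd (a i) 0 (Pi.single i 1)
    rw [smul_zero, ← Pi.single_smul, smul_eq_mul, mul_one] at h2
    rw [h2, mul_comm]
    exact mul_le_mul_of_nonneg_left (norm_le_pi_norm a i) (hd.nonneg _ _)
  obtain ⟨A, hA, ha⟩ := ha
  obtain ⟨B, hB, hb⟩ := hb
  set Z := d ((0, 0, 1) : Pt n) 0 with hZ
  have hZ0 : 0 ≤ Z := hd.nonneg _ _
  refine ⟨A + B + Z * (1 + n) + 1, by positivity, fun p => ?_⟩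
  have hp : p = mul (p.1, 0, 0) (mul (0, p.2.1, 0)
      (0, 0, p.2.2 - (1 / 2) * ∑ j, p.2.1 j * p.1 j)) := by
    refine Prod.ext ?_ (Prod.ext ?_ ?_) <;> simp [mul]
  have h1 : d p 0 ≤ A * ‖p.1‖ + (B * ‖p.2.1‖ +
      Real.sqrt |p.2.2 - (1 / 2) * ∑ j, p.2.1 j * p.1 j| * Z) := by
    rw [hZ, ← norm_vert hd]
    conv_lhs => rw [hp]
    refine (hd.norm_mul_le _ _).trans (add_le_add (ha _) ?_)
    exact (hd.norm_mul_le _ _).trans (add_le_add (hb _) le_rfl)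
  have hx := norm_nonneg p.1
  have hy := norm_nonneg p.2.1
  have hs := Real.sqrt_nonneg |p.2.2|
  have h2 : Real.sqrt |p.2.2 - (1 / 2) * ∑ j, p.2.1 j * p.1 j| ≤
      Real.sqrt |p.2.2| + n * (‖p.1‖ + ‖p.2.1‖) := by
    apply Real.sqrt_le_iff.2
    refine ⟨by positivity, ?_⟩
    have h3 : |∑ j, p.2.1 j * p.1 j| ≤ n * (‖p.2.1‖ * ‖p.1‖) := by
      refine (Finset.abs_sum_le_sum_abs _ _).trans ?_
      have : ∀ j ∈ (Finset.univ : Finset (Fin n)), |p.2.1 j * p.1 j| ≤ ‖p.2.1‖ * ‖p.1‖ := by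
        intro j _
        rw [abs_mul]
        exact mul_le_mul (norm_le_pi_norm p.2.1 j) (norm_le_pi_norm p.1 j) (abs_nonneg _) hy
      simpa using Finset.sum_le_card_nsmul _ _ _ this
    have h4 : |p.2.2 - (1 / 2) * ∑ j, p.2.1 j * p.1 j| ≤
        |p.2.2| + (1 / 2) * |∑ j, p.2.1 j * p.1 j| := by
      refine (abs_sub _ _).trans ?_
      rw [abs_mul, abs_of_pos (by norm_num : (0 : ℝ) < 1 / 2)]
    have h5 := Real.sq_sqrt (abs_nonneg p.2.2)
    have h6 : (n : ℝ) ≤ n ^ 2 := by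
      exact_mod_cast Nat.le_self_pow (by norm_num) n
    have h7 : (n : ℝ) * (‖p.2.1‖ * ‖p.1‖) ≤ n ^ 2 * (‖p.2.1‖ * ‖p.1‖) :=
      mul_le_mul_of_nonneg_right h6 (by positivity)
    have h8 : 0 ≤ Real.sqrt |p.2.2| * (n * (‖p.1‖ + ‖p.2.1‖)) := by positivity
    have h9 : 0 ≤ (n : ℝ) ^ 2 * (‖p.1‖ ^ 2 + ‖p.2.1‖ ^ 2) := by positivity
    have h10 : 0 ≤ (n : ℝ) ^ 2 * (‖p.2.1‖ * ‖p.1‖) := by positivity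
    nlinarith
  have h3 := mul_le_mul_of_nonneg_right h2 hZ0
  unfold hom
  have hn0 : (0 : ℝ) ≤ n := Nat.cast_nonneg n
  have e1 : 0 ≤ (B + Z + 1) * ‖p.1‖ := by positivity
  have e2 : 0 ≤ (A + Z + 1) * ‖p.2.1‖ := by positivity
  have e3 : 0 ≤ (A + B + Z * n + 1) * Real.sqrt |p.2.2| := by positivity
  nlinarith

theorem abs_norm_sub_le (hd : IsLIHomDist d) (p q : Pt n) : |d p 0 - d q 0| ≤ d p q := by
  rw [abs_le]
  have h1 := hd.triangle p q 0
  have h2 := hd.triangle q p 0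
  rw [hd.symm q p] at h2
  constructor <;> linarith

theorem norm_continuous (hd : IsLIHomDist d) : Continuous (fun p => d p 0) := by
  obtain ⟨C, hC, h⟩ := exists_upper hd
  rw [continuous_iff_continuousAt]
  intro q
  rw [ContinuousAt, tendsto_iff_dist_tendsto_zero]
  have h1 : Filter.Tendsto (fun p => C * hom (mul (inv p) q)) (𝓝 q) (𝓝 0) := by
    have hc : Continuous (fun p : Pt n => C * hom (mul (inv p) q)) := by
      refine continuous_const.mul (hom_continuous.comp ?_)
      exact mul_continuous.comp (inv_continuous.prodMk continuous_const)
    have := hc.tendsto q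
    rwa [inv_mul, hom_zero, mul_zero] at this
  refine squeeze_zero (fun _ => dist_nonneg) (fun p => ?_) h1
  rw [Real.dist_eq]
  exact ((abs_norm_sub_le hd p q).trans_eq (hd.eq_norm p q)).trans (h _)

theorem dist_continuous (hd : IsLIHomDist d) : Continuous (fun z : Pt n × Pt n => d z.1 z.2) := by
  have : (fun z : Pt n × Pt n => d z.1 z.2) = fun z => d (mul (inv z.1) z.2) 0 := by
    funext z; exact hd.eq_norm _ _
  rw [this]
  exact (norm_continuous hd).comp
    (mul_continuous.comp ((inv_continuous.comp continuous_fst).prodMk continuous_snd))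

theorem hom_le_compact (R : ℝ) : IsCompact {p : Pt n | hom p ≤ R} := by
  refine Metric.isCompact_of_isClosed_isBounded (isClosed_le hom_continuous continuous_const) ?_
  refine (Metric.isBounded_closedBall (x := (0 : Pt n)) (r := |R| + R ^ 2)).subset ?_
  intro p hp
  simp only [Set.mem_ofPred_eq, hom] at hp
  have hx := norm_nonneg p.1
  have hy := norm_nonneg p.2.1
  have hs := Real.sqrt_nonneg |p.2.2|
  have h5 := Real.sq_sqrt (abs_nonneg p.2.2)
  have hR := le_abs_self R
  have hR2 := sq_nonneg R
  rw [mem_closedBall_zero_iff, Prod.norm_def, Prod.norm_def]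
  refine max_le (by linarith) (max_le (by linarith) ?_)
  rw [Real.norm_eq_abs]
  nlinarith [abs_nonneg R]

theorem exists_lower (hd : IsLIHomDist d) : ∃ C : ℝ, 0 < C ∧ ∀ p : Pt n, hom p ≤ C * d p 0 := by
  have hK : IsCompact {p : Pt n | hom p = 1} := by
    refine (hom_le_compact 1).of_isClosed_subset (isClosed_eq hom_continuous continuous_const) ?_
    intro p hp
    exact le_of_eq hp
  have hne : {p : Pt n | hom p = 1}.Nonempty := ⟨(0, 0, 1), by simp [hom]⟩
  obtain ⟨q, hq, hmin⟩ := hK.exists_isMinOn hne (norm_continuous hd).continuousOn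
  have hq0 : 0 < d q 0 := by
    refine lt_of_le_of_ne (hd.nonneg _ _) fun h => ?_
    have := hd.eq_of_dist_eq_zero _ _ h.symm
    subst this
    simp [hom_zero] at hq
  refine ⟨(d q 0)⁻¹, inv_pos.2 hq0, fun p => ?_⟩
  rcases (hom_nonneg p).eq_or_lt with h | h
  · rw [← h]; exact mul_nonneg (inv_pos.2 hq0).le (hd.nonneg _ _)
  · have h1 : hom (dil (hom p)⁻¹ p) = 1 := by
      rw [hom_dil (inv_pos.2 h), inv_mul_cancel₀ h.ne']
    have h2 : d q 0 ≤ d (dil (hom p)⁻¹ p) 0 := hmin h1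
    rw [hd.norm_dil (inv_pos.2 h), le_inv_mul_iff₀ h] at h2
    rw [le_inv_mul_iff₀ hq0]
    linarith

end dist
section graph
set_option linter.unusedSectionVars false
set_option linter.unusedSimpArgs false
variable [NeZero n] {d : Pt n → Pt n → ℝ} {L : ℝ} {φv : Pt n → ℝ}

theorem projW_mul_ell (u : Pt n) (hu : u.1 0 = 0) (a : ℝ) : projW (mul u (ell a)) = u := by
  have h : projL (mul u (ell a)) = ell a := by
    simp [projL, ell, mul, hu]
  rw [projW, h, mul_assoc', mul_inv', mul_zero']

theorem projL_mul_ell (u : Pt n) (hu : u.1 0 = 0) (a : ℝ) : projL (mul u (ell a)) = ell a := by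
  simp [projL, ell, mul, hu]

theorem projL_eq (p : Pt n) : projL p = ell (p.1 0) := rfl

theorem projW_fst (p : Pt n) : (projW p).1 0 = 0 := by
  simp [projW, mul, inv, projL]

theorem projW_snd (p : Pt n) : (projW p).2.1 = p.2.1 := by
  simp [projW, mul, inv, projL]

theorem projW_mul_projL (p : Pt n) : mul (projW p) (ell (p.1 0)) = p := by
  rw [projW, projL_eq, mul_assoc', inv_mul, mul_zero']

theorem cone_le (hd : IsLIHomDist d) (hL : 0 < L) (hφ : IsIntrinsicLip d L φv) {p q : Pt n}
    (hp : p ∈ graphSet φv) (hq : q ∈ graphSet φv) :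
    d (projL (mul (inv p) q)) 0 ≤ L * d (projW (mul (inv p) q)) 0 := by
  obtain ⟨w, hw, rfl⟩ := hp
  obtain ⟨w', hw', rfl⟩ := hq
  by_cases h : w = w'
  · subst h
    rw [inv_mul]
    have : projL (0 : Pt n) = 0 := by simp [projL]
    rw [this, hd.self]
    exact mul_nonneg hL.le (hd.nonneg _ _)
  · have h1 := mt (hφ w w' hw hw') h
    rw [not_le, one_div, inv_mul_lt_iff₀ hL] at h1
    exact h1.le

theorem graph_unique (hd : IsLIHomDist d) (hL : 0 < L) (hφ : IsIntrinsicLip d L φv) {p : Pt n}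
    {a : ℝ} (hp : p ∈ graphSet φv) (hq : mul p (ell a) ∈ graphSet φv) : mul p (ell a) = p := by
  have h := cone_le hd hL hφ hp hq
  rw [inv_mul_cancel] at h
  have h1 := projW_mul_ell (0 : Pt n) rfl a
  have h2 := projL_mul_ell (0 : Pt n) rfl a
  rw [zero_mul'] at h1 h2
  rw [h1, h2, hd.self, mul_zero] at h
  have := hd.eq_of_dist_eq_zero _ _ (le_antisymm h (hd.nonneg _ _))
  rw [this, mul_zero']

theorem graph_step (hd : IsLIHomDist d) (hL : 0 < L) (hφ : IsIntrinsicLip d L φv) {p : Pt n}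
    (hp : p ∈ graphSet φv) (u : Pt n) (hu : u.1 0 = 0) :
    ∃ a, mul p (mul u (ell a)) ∈ graphSet φv ∧
      d p (mul p (mul u (ell a))) ≤ (1 + L) * d u 0 := by
  have hex : ∃ a, mul p (mul u (ell a)) ∈ graphSet φv := by
    obtain ⟨w, hw, rfl⟩ := hp
    set f := φv w
    set w' := mul w (mul (ell f) (mul u (ell (-f)))) with hw'
    refine ⟨-f + φv w', w', ?_, ?_⟩
    · simp [hw', mul, ell, hw, hu]
    · show mul (mul w (ell f)) (mul u (ell (-f + φv w'))) = mul w' (ell (φv w'))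
      rw [hw', ← ell_mul_ell]
      simp only [mul_assoc']
  obtain ⟨a, ha⟩ := hex
  refine ⟨a, ha, ?_⟩
  have h := cone_le hd hL hφ hp ha
  rw [inv_mul_cancel, projW_mul_ell u hu, projL_mul_ell u hu] at h
  rw [hd.mul_norm]
  refine (hd.norm_mul_le _ _).trans ?_
  linarith

theorem graph_closed (hd : IsLIHomDist d) (hL : 0 < L) (hφ : IsIntrinsicLip d L φv) :
    IsClosed (graphSet φv) := by
  rw [← isSeqClosed_iff_isClosed]
  intro s p hs hlim
  obtain ⟨a, ha⟩ : ∃ a, mul p (ell a) ∈ graphSet φv := by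
    refine ⟨-(p.1 0) + φv (projW p), projW p, projW_fst p, ?_⟩
    have h : mul p (ell (-(p.1 0) + φv (projW p))) =
        mul (mul (projW p) (ell (p.1 0))) (ell (-(p.1 0) + φv (projW p))) := by
      rw [projW_mul_projL]
    rw [h, mul_assoc', ell_mul_ell, add_neg_cancel_left]
    rfl
  set q := mul p (ell a) with hq
  have hcont1 : Continuous (fun z : Pt n => d (projL (mul (inv q) z)) 0) := by
    refine (norm_continuous hd).comp ?_
    have h1 : Continuous (fun z : Pt n => mul (inv q) z) :=
      mul_continuous.comp (continuous_const.prodMk continuous_id)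
    have h2 : Continuous (projL : Pt n → Pt n) := by
      unfold projL
      have : Continuous (fun t : ℝ => (Pi.single 0 t : Fin n → ℝ)) :=
        continuous_single (A := fun _ : Fin n => ℝ) 0
      fun_prop
    exact h2.comp h1
  have hcont2 : Continuous (fun z : Pt n => L * d (projW (mul (inv q) z)) 0) := by
    refine continuous_const.mul ((norm_continuous hd).comp ?_)
    have h1 : Continuous (fun z : Pt n => mul (inv q) z) :=
      mul_continuous.comp (continuous_const.prodMk continuous_id)
    have h2 : Continuous (projL : Pt n → Pt n) := by
      unfold projL
      have : Continuous (fun t : ℝ => (Pi.single 0 t : Fin n → ℝ)) :=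
        continuous_single (A := fun _ : Fin n => ℝ) 0
      fun_prop
    have h3 : Continuous (projW : Pt n → Pt n) :=
      mul_continuous.comp (continuous_id.prodMk (inv_continuous.comp h2))
    exact h3.comp h1
  have hle := le_of_tendsto_of_tendsto' ((hcont1.tendsto p).comp hlim)
    ((hcont2.tendsto p).comp hlim) (fun k => cone_le hd hL hφ ha (hs k))
  have hqp : mul (inv q) p = ell (-a) := by
    have : p = mul q (ell (-a)) := by
      rw [hq, mul_assoc', ell_mul_ell, add_neg_cancel, ell_zero, mul_zero']
    conv_lhs => rw [this]
    rw [inv_mul_cancel]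
  have h1 := projW_mul_ell (0 : Pt n) rfl (-a)
  have h2 := projL_mul_ell (0 : Pt n) rfl (-a)
  rw [zero_mul'] at h1 h2
  rw [hqp, h1, h2, hd.self, mul_zero] at hle
  have h0 := hd.eq_of_dist_eq_zero _ _ (le_antisymm hle (hd.nonneg _ _))
  rw [← inv_ell] at h0
  have h3 : (ell a : Pt n) = 0 := by
    rw [← inv_inv' (ell a), h0]; simp [inv]
  rw [hq, h3, mul_zero'] at ha
  exact ha

/-- `k`-step chains in `Γ` with steps of size at most `δ`. -/
def Reach (d : Pt n → Pt n → ℝ) (Γ : Set (Pt n)) (δ : ℝ) (k : ℕ) (p q : Pt n) : Prop :=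
  ∃ g : ℕ → Pt n, g 0 = p ∧ g k = q ∧ (∀ i ≤ k, g i ∈ Γ) ∧ ∀ i < k, d (g i) (g (i + 1)) ≤ δ

theorem Reach.trans {Γ : Set (Pt n)} {δ : ℝ} {k l : ℕ} {p q r : Pt n}
    (h1 : Reach d Γ δ k p q) (h2 : Reach d Γ δ l q r) : Reach d Γ δ (k + l) p r := by
  obtain ⟨g, hg0, hgk, hgΓ, hgd⟩ := h1
  obtain ⟨f, hf0, hfl, hfΓ, hfd⟩ := h2
  have hF : ∀ i, k ≤ i → (if i ≤ k then g i else f (i - k)) = f (i - k) := by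
    intro i hi
    split_ifs with h
    · have : i = k := le_antisymm h hi
      subst this
      rw [hgk, Nat.sub_self, hf0]
    · rfl
  refine ⟨fun i => if i ≤ k then g i else f (i - k), ?_, ?_, ?_, ?_⟩
  · simp [hg0]
  · show (if k + l ≤ k then g (k + l) else f (k + l - k)) = r
    rw [hF _ (Nat.le_add_right _ _), Nat.add_sub_cancel_left, hfl]
  · intro i hi
    show (if i ≤ k then g i else f (i - k)) ∈ Γ
    split_ifs with h
    · exact hgΓ i h
    · exact hfΓ _ (by omega)
  · intro i hi
    show d (if i ≤ k then g i else f (i - k))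
      (if i + 1 ≤ k then g (i + 1) else f (i + 1 - k)) ≤ δ
    by_cases h : i + 1 ≤ k
    · rw [if_pos h, if_pos (by omega)]
      exact hgd i (by omega)
    · rw [hF i (by omega), if_neg h]
      have : i + 1 - k = (i - k) + 1 := by omega
      rw [this]
      exact hfd _ (by omega)

theorem Reach.refl {Γ : Set (Pt n)} {δ : ℝ} {p : Pt n} (hp : p ∈ Γ) : Reach d Γ δ 0 p p :=
  ⟨fun _ => p, rfl, rfl, fun _ _ => hp, fun i hi => absurd hi (Nat.not_lt_zero i)⟩

theorem Reach.single {Γ : Set (Pt n)} {δ : ℝ} {p q : Pt n} (hp : p ∈ Γ) (hq : q ∈ Γ)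
    (h : d p q ≤ δ) : Reach d Γ δ 1 p q := by
  refine ⟨fun i => if i = 0 then p else q, by simp, by simp, fun i _ => ?_, fun i hi => ?_⟩
  · show (if i = 0 then p else q) ∈ Γ
    split_ifs <;> assumption
  · have : i = 0 := by omega
    subst this
    simpa using h

theorem Reach.mem {Γ : Set (Pt n)} {δ : ℝ} {k : ℕ} {p q : Pt n}
    (h : Reach d Γ δ k p q) : q ∈ Γ := by
  obtain ⟨g, hg0, hgk, hgΓ, hgd⟩ := h
  rw [← hgk]; exact hgΓ k le_rfl

theorem chain_dist (hd : IsLIHomDist d) {δ : ℝ} {k : ℕ} {g : ℕ → Pt n}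
    (hg : ∀ i < k, d (g i) (g (i + 1)) ≤ δ) (i j : ℕ) (hj : i + j ≤ k) :
    d (g i) (g (i + j)) ≤ δ * j := by
  induction j with
  | zero => simp [hd.self]
  | succ j ih =>
    have h1 := ih (by omega)
    have h2 := hg (i + j) (by omega)
    have h3 := hd.triangle (g i) (g (i + j)) (g (i + j + 1))
    rw [← add_assoc]
    push_cast
    linarith

theorem Reach.dist_le (hd : IsLIHomDist d) {Γ : Set (Pt n)} {δ : ℝ} {k : ℕ} {p q : Pt n}
    (h : Reach d Γ δ k p q) : d p q ≤ δ * k := by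
  obtain ⟨g, hg0, hgk, hgΓ, hgd⟩ := h
  have := chain_dist hd hgd 0 k (by omega)
  rwa [zero_add, hg0, hgk] at this

/-- One can follow `h` (up to the `𝕃`-direction) inside `Γ` by a `k`-step chain. -/
def Follow (d : Pt n → Pt n → ℝ) (Γ : Set (Pt n)) (δ : ℝ) (k : ℕ) (h : Pt n) : Prop :=
  h.2.1 0 = 0 ∧ ∀ p ∈ Γ, ∃ a, Reach d Γ δ k p (mul p (mul h (ell a)))

theorem Follow.mul {Γ : Set (Pt n)} {δ : ℝ} {k l : ℕ} {h h' : Pt n} (H : Follow d Γ δ k h)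
    (H' : Follow d Γ δ l h') : Follow d Γ δ (k + l) (Heis.mul h h') := by
  refine ⟨by simp [Heis.mul, H.1, H'.1], fun p hp => ?_⟩
  obtain ⟨a, ha⟩ := H.2 p hp
  obtain ⟨b, hb⟩ := H'.2 _ ha.mem
  refine ⟨a + b, ?_⟩
  have := ha.trans hb
  convert this using 1
  rw [← ell_mul_ell]
  simp only [mul_assoc']
  rw [← mul_assoc' (ell a) h', ell_comm a h' H'.1]
  simp only [mul_assoc']

theorem follow_single (hd : IsLIHomDist d) (hL : 0 < L) (hφ : IsIntrinsicLip d L φv) {δ : ℝ}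
    (h : Pt n) (h1 : h.1 0 = 0) (h2 : h.2.1 0 = 0) (hδ : (1 + L) * d h 0 ≤ δ) :
    Follow d (graphSet φv) δ 1 h := by
  refine ⟨h2, fun p hp => ?_⟩
  obtain ⟨a, ha, hda⟩ := graph_step hd hL hφ hp h h1
  exact ⟨a, Reach.single hp ha (hda.trans hδ)⟩

theorem mul_hor (k : ℕ) (a b : Fin n → ℝ) :
    mul (((k : ℝ) • a, (k : ℝ) • b, 0) : Pt n) (a, b, 0) =
      (((k + 1 : ℕ) : ℝ) • a, ((k + 1 : ℕ) : ℝ) • b, 0) := by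
  refine Prod.ext ?_ (Prod.ext ?_ ?_)
  · simp [mul, add_smul]
  · simp [mul, add_smul]
  · simp only [mul, Pi.smul_apply, smul_eq_mul, add_zero, zero_add]
    rw [Finset.sum_eq_zero, mul_zero]
    intro j _
    ring

theorem follow_hor_aux (hd : IsLIHomDist d) (hL : 0 < L) (hφ : IsIntrinsicLip d L φv) {δ : ℝ}
    (a b : Fin n → ℝ) (h1 : a 0 = 0) (h2 : b 0 = 0) (hδ : (1 + L) * d (a, b, 0) 0 ≤ δ) (k : ℕ) :
    Follow d (graphSet φv) δ k ((k : ℝ) • a, (k : ℝ) • b, 0) := by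
  induction k with
  | zero =>
    refine ⟨by simp, fun p hp => ⟨0, ?_⟩⟩
    rw [ell_zero, mul_zero']
    have : (((0 : ℕ) : ℝ) • a, ((0 : ℕ) : ℝ) • b, (0 : ℝ)) = (0 : Pt n) := by
      simp
    rw [this, mul_zero']
    exact Reach.refl hp
  | succ k ih =>
    rw [← mul_hor]
    exact ih.mul (follow_single hd hL hφ (a, b, 0) h1 h2 hδ)

theorem norm_hor_div (hd : IsLIHomDist d) (a b : Fin n → ℝ) (N : ℕ) :
    d ((N : ℝ)⁻¹ • a, (N : ℝ)⁻¹ • b, 0) 0 = d (a, b, 0) 0 / N := by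
  rw [norm_hor_smul hd, abs_of_nonneg (by positivity), div_eq_inv_mul]

theorem follow_hor (hd : IsLIHomDist d) (hL : 0 < L) (hφ : IsIntrinsicLip d L φv) {δ : ℝ}
    (a b : Fin n → ℝ) (h1 : a 0 = 0) (h2 : b 0 = 0) (N : ℕ) (hN : 0 < N)
    (hδ : (1 + L) * (d (a, b, 0) 0 / N) ≤ δ) :
    Follow d (graphSet φv) δ N (a, b, 0) := by
  have hN' : (N : ℝ) ≠ 0 := by positivity
  have := follow_hor_aux (δ := δ) hd hL hφ ((N : ℝ)⁻¹ • a) ((N : ℝ)⁻¹ • b) (by simp [h1]) (by simp [h2])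
    (by rw [norm_hor_div hd]; exact hδ) N
  rwa [smul_inv_smul₀ hN', smul_inv_smul₀ hN'] at this

theorem reach_vert (hd : IsLIHomDist d) (hL : 0 < L) (hφ : IsIntrinsicLip d L φv) {δ : ℝ}
    (b : Fin n → ℝ) (hδ : (1 + L) * d (0, b, 0) 0 ≤ δ) {p : Pt n} (hp : p ∈ graphSet φv) (k : ℕ) :
    ∃ q, Reach d (graphSet φv) δ k p q ∧ q.2.1 = p.2.1 + (k : ℝ) • b := by
  induction k with
  | zero => exact ⟨p, Reach.refl hp, by simp⟩
  | succ k ih =>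
    obtain ⟨q, hq, hqb⟩ := ih
    obtain ⟨a, ha, hda⟩ := graph_step hd hL hφ hq.mem (0, b, 0) rfl
    refine ⟨_, hq.trans (Reach.single hq.mem ha (hda.trans hδ)), ?_⟩
    simp [mul, ell, hqb, add_smul, add_assoc]

theorem comm_eq (i : Fin n) (s t : ℝ) :
    mul (Pi.single i s, 0, 0) (mul (0, Pi.single i t, 0) (mul (Pi.single i (-s), 0, 0)
      (0, Pi.single i (-t), 0))) = ((0, 0, s * t) : Pt n) := by
  have key : ∀ x y : ℝ, ∑ j, (Pi.single i x : Fin n → ℝ) j * (Pi.single i y : Fin n → ℝ) j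
      = x * y := by
    intro x y
    rw [Finset.sum_eq_single i]
    · simp
    · intro b _ hb; simp [hb]
    · simp
  refine Prod.ext ?_ (Prod.ext ?_ ?_)
  · simp [mul, Pi.single_neg]
  · simp [mul, Pi.single_neg]
  · simp only [mul, Pi.zero_apply, Pi.add_apply, zero_mul, mul_zero, sub_zero, zero_sub,
      add_zero, zero_add, Finset.sum_neg_distrib, Finset.sum_sub_distrib, add_mul, mul_add,
      Finset.sum_add_distrib, key, Finset.sum_const_zero]
    ring

/-- Follow an arbitrary element of `ℍⁿ⁻¹`. -/
theorem follow_all (hn : 2 ≤ n) (hd : IsLIHomDist d) (hL : 0 < L) (hφ : IsIntrinsicLip d L φv)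
    {C₁ : ℝ} (hC₁ : 0 < C₁) (hup : ∀ p : Pt n, d p 0 ≤ C₁ * hom p) {δ : ℝ}
    (u : Pt n) (h1 : u.1 0 = 0) (h2 : u.2.1 0 = 0) (N : ℕ) (hN : 0 < N)
    (hδ : (1 + L) * (C₁ * hom u / N) ≤ δ) :
    Follow d (graphSet φv) δ (5 * N) u := by
  have hN' : (0 : ℝ) < N := by positivity
  have bound : ∀ p : Pt n, hom p ≤ hom u → (1 + L) * (d p 0 / N) ≤ δ := by
    intro p hp
    refine le_trans ?_ hδ
    have : d p 0 ≤ C₁ * hom u := (hup p).trans (mul_le_mul_of_nonneg_left hp hC₁.le)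
    gcongr
  let i : Fin n := ⟨1, hn⟩
  have hi : (0 : Fin n) ≠ i := by
    intro h
    have := congrArg Fin.val h
    simp [i] at this
  have hx := norm_nonneg u.1
  have hy := norm_nonneg u.2.1
  obtain ⟨s, t, hst, hs, ht⟩ : ∃ s t : ℝ, s * t = u.2.2 ∧ |s| ≤ hom u ∧ |t| ≤ hom u := by
    have h3 : Real.sqrt |u.2.2| ≤ hom u := by unfold hom; linarith
    have h4 := Real.mul_self_sqrt (abs_nonneg u.2.2)
    have h5 := Real.sqrt_nonneg |u.2.2|
    rcases le_total 0 u.2.2 with h | h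
    · refine ⟨Real.sqrt |u.2.2|, Real.sqrt |u.2.2|, ?_, ?_, ?_⟩
      · rw [h4, abs_of_nonneg h]
      · rwa [abs_of_nonneg h5]
      · rwa [abs_of_nonneg h5]
    · refine ⟨Real.sqrt |u.2.2|, -Real.sqrt |u.2.2|, ?_, ?_, ?_⟩
      · rw [mul_neg, h4, abs_of_nonpos h, neg_neg]
      · rwa [abs_of_nonneg h5]
      · rwa [abs_neg, abs_of_nonneg h5]
  have hA : ∀ r : ℝ, |r| ≤ hom u → Follow d (graphSet φv) δ N (Pi.single i r, 0, 0) := by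
    intro r hr
    refine follow_hor hd hL hφ _ _ (by simp [hi]) rfl N hN (bound _ ?_)
    simpa [hom, Pi.norm_single] using hr
  have hB : ∀ r : ℝ, |r| ≤ hom u → Follow d (graphSet φv) δ N (0, Pi.single i r, 0) := by
    intro r hr
    refine follow_hor hd hL hφ _ _ rfl (by simp [hi]) N hN (bound _ ?_)
    simpa [hom, Pi.norm_single] using hr
  have hV : Follow d (graphSet φv) δ N (u.1, u.2.1, 0) := by
    refine follow_hor hd hL hφ _ _ h1 h2 N hN (bound _ ?_)
    simp [hom]
  have hfin := hV.mul ((hA s hs).mul ((hB t ht).mul ((hA (-s) (by rwa [abs_neg])).mul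
    (hB (-t) (by rwa [abs_neg])))))
  rw [comm_eq, hst] at hfin
  have hu : mul (u.1, u.2.1, 0) (0, 0, u.2.2) = u := by
    refine Prod.ext ?_ (Prod.ext ?_ ?_) <;> simp [mul]
  rw [hu] at hfin
  convert hfin using 1
  ring

theorem exists_chain (hn : 2 ≤ n) (hd : IsLIHomDist d) (hL : 0 < L)
    (hφ : IsIntrinsicLip d L φv) :
    ∃ K : ℝ, 0 ≤ K ∧ ∀ x ∈ graphSet φv, ∀ y ∈ graphSet φv, ∀ N : ℕ, 0 < N →
      Reach d (graphSet φv) (K * d x y / N) (6 * N) x y := by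
  obtain ⟨C₁, hC₁, hup⟩ := exists_upper hd
  obtain ⟨C₂, hC₂, hlo⟩ := exists_lower hd
  set A := (1 + L) * (C₁ * C₂) with hA
  have hA0 : 0 < A := by positivity
  set B := A * ((C₁ * C₂ + 1) * (1 + A)) with hB
  have hB0 : 0 < B := by positivity
  refine ⟨A + B, by positivity, fun x hx y hy N hN => ?_⟩
  have hN' : (0 : ℝ) < N := by positivity
  set D := d x y with hD
  have hD0 : 0 ≤ D := hd.nonneg _ _
  -- first move in the direction `X_{n+1}`
  set T := y.2.1 0 - x.2.1 0 with hT
  have hT1 : |T| ≤ C₂ * D := by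
    have h1 := hlo (mul (inv x) y)
    rw [← hd.eq_norm] at h1
    refine le_trans ?_ h1
    have h2 : |T| ≤ ‖(mul (inv x) y).2.1‖ := by
      refine le_trans (le_of_eq ?_) (norm_le_pi_norm _ 0)
      simp [mul, inv, hT, sub_eq_neg_add]
    have h3 := norm_nonneg (mul (inv x) y).1
    have h4 := Real.sqrt_nonneg |(mul (inv x) y).2.2|
    unfold hom
    linarith
  have hb : (1 + L) * d (0, (N : ℝ)⁻¹ • (Pi.single 0 T : Fin n → ℝ), 0) 0 ≤ A * D / N := by
    have h1 := norm_hor_div hd 0 (Pi.single 0 T : Fin n → ℝ) N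
    rw [smul_zero] at h1
    rw [h1]
    have h2 : d (0, (Pi.single 0 T : Fin n → ℝ), 0) 0 ≤ C₁ * (C₂ * D) := by
      refine (hup _).trans (mul_le_mul_of_nonneg_left ?_ hC₁.le)
      simpa [hom, Pi.norm_single] using hT1
    rw [hA, ← mul_div_assoc]
    refine div_le_div_of_nonneg_right ?_ hN'.le
    have h3 := mul_le_mul_of_nonneg_left h2 (by linarith : (0 : ℝ) ≤ 1 + L)
    linarith
  have hle1 : A * D / N ≤ (A + B) * D / N := by
    gcongr
    linarith
  have hle2 : B * D / N ≤ (A + B) * D / N := by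
    gcongr
    linarith
  obtain ⟨x', hx', hxb⟩ := reach_vert hd hL hφ _ hb hx N
  rw [smul_inv_smul₀ hN'.ne'] at hxb
  have hd1 : d x x' ≤ A * D := by
    have := hx'.dist_le hd
    rwa [div_mul_cancel₀ _ hN'.ne'] at this
  have hd2 : d x' y ≤ (1 + A) * D := by
    have := hd.triangle x' x y
    rw [hd.symm x' x] at this
    linarith
  set q := mul (inv x') y with hq
  have hqn : d q 0 ≤ (1 + A) * D := by rwa [hq, ← hd.eq_norm]
  set u := projW q with hu
  have hun : d u 0 ≤ (C₁ * C₂ + 1) * ((1 + A) * D) := by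
    have h1 : d u 0 ≤ d q 0 + d (ell (q.1 0)) 0 := by
      rw [hu, projW, projL_eq, ← hd.norm_inv (ell (q.1 0))]
      exact hd.norm_mul_le _ _
    have h2 : d (ell (q.1 0) : Pt n) 0 ≤ C₁ * (C₂ * d q 0) := by
      refine (hup _).trans (mul_le_mul_of_nonneg_left ?_ hC₁.le)
      refine le_trans ?_ (hlo q)
      have h3 : |q.1 0| ≤ ‖q.1‖ := norm_le_pi_norm q.1 0
      have h4 := norm_nonneg q.2.1
      have h5 := Real.sqrt_nonneg |q.2.2|
      have h6 : hom (ell (q.1 0) : Pt n) = |q.1 0| := by simp [hom, ell, Pi.norm_single]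
      rw [h6]
      unfold hom
      linarith
    have h3 : (C₁ * C₂ + 1) * d q 0 ≤ (C₁ * C₂ + 1) * ((1 + A) * D) := by gcongr
    linarith
  have hhom : hom u ≤ C₂ * ((C₁ * C₂ + 1) * ((1 + A) * D)) :=
    (hlo u).trans (mul_le_mul_of_nonneg_left hun hC₂.le)
  have hF : Follow d (graphSet φv) (B * D / N) (5 * N) u := by
    refine follow_all hn hd hL hφ hC₁ hup u (projW_fst q) ?_ N hN ?_
    · rw [hu, projW_snd, hq]
      simp [mul, inv, hxb, hT]
      ring
    · rw [← mul_div_assoc]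
      refine div_le_div_of_nonneg_right ?_ hN'.le
      have : (1 + L) * (C₁ * hom u) ≤ (1 + L) * (C₁ * (C₂ * ((C₁ * C₂ + 1) * ((1 + A) * D)))) := by
        gcongr
      refine this.trans (le_of_eq ?_)
      rw [hB, hA]; ring
  obtain ⟨a, ha⟩ := hF.2 x' hx'.mem
  have hend : mul x' (mul u (ell a)) = y := by
    have h1 : y = mul (mul x' (mul u (ell a))) (ell (-a + q.1 0)) := by
      simp only [mul_assoc', ell_mul_ell]
      rw [add_neg_cancel_left, hu, projW_mul_projL, hq, mul_inv_cancel]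
    have h2 := graph_unique hd hL hφ ha.mem (h1 ▸ hy)
    rw [← h1] at h2
    exact h2.symm
  rw [hend] at ha
  have h6 : 6 * N = N + 5 * N := by ring
  rw [h6]
  have mono : ∀ {δ δ' : ℝ} {k : ℕ} {p q : Pt n}, δ ≤ δ' → Reach d (graphSet φv) δ k p q →
      Reach d (graphSet φv) δ' k p q := by
    rintro δ δ' k p q h ⟨g, h0, h1, h2, h3⟩
    exact ⟨g, h0, h1, h2, fun i hi => (h3 i hi).trans h⟩
  exact (mono hle1 hx').trans (mono hle2 ha)

end graph
section curves
variable {d : Pt n → Pt n → ℝ}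

theorem exists_hcurve (hd : IsLIHomDist d) (γ : ℝ → Pt n) (K : ℝ) (hK : 0 ≤ K)
    (hγ : ∀ s t, d (γ s) (γ t) ≤ K * |s - t|) : ∃ c, IsHCurve γ c 0 1 := by
  obtain ⟨C₂, hC₂, hlo⟩ := exists_lower hd
  set M := C₂ * K with hM
  have hM0 : 0 ≤ M := by positivity
  have hhom : ∀ s t, hom (mul (inv (γ s)) (γ t)) ≤ M * |s - t| := by
    intro s t
    refine (hlo _).trans ?_
    rw [← hd.eq_norm, hM, mul_assoc]
    exact mul_le_mul_of_nonneg_left (hγ s t) hC₂.le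
  have ha : ∀ j s t, |(γ s).1 j - (γ t).1 j| ≤ M * |s - t| := by
    intro j s t
    refine le_trans ?_ (hhom s t)
    have h1 := norm_le_pi_norm (mul (inv (γ s)) (γ t)).1 j
    have h2 : ‖(mul (inv (γ s)) (γ t)).1 j‖ = |(γ s).1 j - (γ t).1 j| := by
      rw [abs_sub_comm]
      simp [mul, inv, sub_eq_neg_add]
    rw [h2] at h1
    have h3 := norm_nonneg (mul (inv (γ s)) (γ t)).2.1
    have h4 := Real.sqrt_nonneg |(mul (inv (γ s)) (γ t)).2.2|
    unfold hom
    linarith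
  have hb : ∀ j s t, |(γ s).2.1 j - (γ t).2.1 j| ≤ M * |s - t| := by
    intro j s t
    refine le_trans ?_ (hhom s t)
    have h1 := norm_le_pi_norm (mul (inv (γ s)) (γ t)).2.1 j
    have h2 : ‖(mul (inv (γ s)) (γ t)).2.1 j‖ = |(γ s).2.1 j - (γ t).2.1 j| := by
      rw [abs_sub_comm]
      simp [mul, inv, sub_eq_neg_add]
    rw [h2] at h1
    have h3 := norm_nonneg (mul (inv (γ s)) (γ t)).1
    have h4 := Real.sqrt_nonneg |(mul (inv (γ s)) (γ t)).2.2|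
    unfold hom
    linarith
  let W : ℝ → ℝ → ℝ := fun s t => (1 / 2) * ∑ j, (((γ t).2.1 j - (γ s).2.1 j) * (γ s).1 j -
    ((γ t).1 j - (γ s).1 j) * (γ s).2.1 j)
  have hy : ∀ s t, |(γ t).2.2 - (γ s).2.2 - W s t| ≤ M ^ 2 * (s - t) ^ 2 := by
    intro s t
    have h1 : (mul (inv (γ s)) (γ t)).2.2 = (γ t).2.2 - (γ s).2.2 - W s t := by
      simp only [mul, inv, W, Pi.neg_apply]
      have : ∑ j, (((γ t).2.1 j - (γ s).2.1 j) * (γ s).1 j -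
          ((γ t).1 j - (γ s).1 j) * (γ s).2.1 j) =
          - ∑ j, ((γ t).2.1 j * -(γ s).1 j - (γ t).1 j * -(γ s).2.1 j) := by
        rw [← Finset.sum_neg_distrib]
        refine Finset.sum_congr rfl fun j _ => ?_
        ring
      rw [this]
      ring
    rw [← h1]
    have h2 : Real.sqrt |(mul (inv (γ s)) (γ t)).2.2| ≤ M * |s - t| := by
      refine le_trans ?_ (hhom s t)
      have h3 := norm_nonneg (mul (inv (γ s)) (γ t)).1
      have h4 := norm_nonneg (mul (inv (γ s)) (γ t)).2.1
      unfold hom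
      linarith
    rw [Real.sqrt_le_left (by positivity), mul_pow, sq_abs] at h2
    exact h2
  have hLa : ∀ j, LipschitzWith (Real.toNNReal M) (fun t => (γ t).1 j) := fun j =>
    LipschitzWith.of_dist_le_mul fun s t => by
      rw [Real.coe_toNNReal _ hM0]; exact ha j s t
  have hLb : ∀ j, LipschitzWith (Real.toNNReal M) (fun t => (γ t).2.1 j) := fun j =>
    LipschitzWith.of_dist_le_mul fun s t => by
      rw [Real.coe_toNNReal _ hM0]; exact hb j s t
  -- Lipschitz bound for the vertical coordinate
  set Q := ‖(γ 0).1‖ + ‖(γ 0).2.1‖ + M with hQ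
  have hQ0 : 0 ≤ Q := by positivity
  have hQa : ∀ j, ∀ s ∈ Set.Icc (0 : ℝ) 1, |(γ s).1 j| ≤ Q := by
    intro j s hs
    have h1 := ha j s 0
    have h2 : |(γ 0).1 j| ≤ ‖(γ 0).1‖ := norm_le_pi_norm (γ 0).1 j
    have h3 := norm_nonneg (γ 0).2.1
    rw [sub_zero, abs_of_nonneg hs.1] at h1
    have h4 : M * s ≤ M := mul_le_of_le_one_right hM0 hs.2
    have h5 := abs_sub_abs_le_abs_sub ((γ s).1 j) ((γ 0).1 j)
    linarith
  have hQb : ∀ j, ∀ s ∈ Set.Icc (0 : ℝ) 1, |(γ s).2.1 j| ≤ Q := by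
    intro j s hs
    have h1 := hb j s 0
    have h2 : |(γ 0).2.1 j| ≤ ‖(γ 0).2.1‖ := norm_le_pi_norm (γ 0).2.1 j
    have h3 := norm_nonneg (γ 0).1
    rw [sub_zero, abs_of_nonneg hs.1] at h1
    have h4 : M * s ≤ M := mul_le_of_le_one_right hM0 hs.2
    have h5 := abs_sub_abs_le_abs_sub ((γ s).2.1 j) ((γ 0).2.1 j)
    linarith
  set P := n * (M * Q) + M ^ 2 with hP
  have hP0 : 0 ≤ P := by positivity
  have hLy : LipschitzOnWith (Real.toNNReal P) (fun t => (γ t).2.2) (Set.Icc 0 1) := by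
    refine LipschitzOnWith.of_dist_le_mul fun t ht s hs => ?_
    rw [Real.coe_toNNReal _ hP0, Real.dist_eq, Real.dist_eq]
    have h1 := hy s t
    have h2 : |W s t| ≤ n * (M * Q) * |t - s| := by
      have h3 : ∀ j ∈ (Finset.univ : Finset (Fin n)),
          |((γ t).2.1 j - (γ s).2.1 j) * (γ s).1 j -
            ((γ t).1 j - (γ s).1 j) * (γ s).2.1 j| ≤ 2 * (M * Q * |t - s|) := by
        intro j _
        refine (abs_sub _ _).trans ?_
        rw [abs_mul, abs_mul]
        have e1 := mul_le_mul (hb j t s) (hQa j s hs) (abs_nonneg _) (by positivity)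
        have e2 := mul_le_mul (ha j t s) (hQb j s hs) (abs_nonneg _) (by positivity)
        linarith
      have h4 := (Finset.abs_sum_le_sum_abs _ _).trans (Finset.sum_le_card_nsmul _ _ _ h3)
      simp only [Finset.card_univ, Fintype.card_fin, nsmul_eq_mul] at h4
      simp only [W, abs_mul]
      rw [abs_of_pos (by norm_num : (0 : ℝ) < 1 / 2)]
      linarith
    have h3 : (s - t) ^ 2 ≤ |t - s| := by
      rw [← sq_abs, abs_sub_comm]
      have : |t - s| ≤ 1 := by
        rw [abs_le]; constructor <;> linarith [ht.1, ht.2, hs.1, hs.2]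
      nlinarith [abs_nonneg (t - s)]
    have h4 := mul_le_mul_of_nonneg_left h3 (sq_nonneg M)
    have h5 : |(γ t).2.2 - (γ s).2.2| ≤ |(γ t).2.2 - (γ s).2.2 - W s t| + |W s t| := by
      have := abs_add_le ((γ t).2.2 - (γ s).2.2 - W s t) (W s t)
      rwa [sub_add_cancel] at this
    rw [hP]
    linarith
  refine ⟨fun s => (fun j => deriv (fun t => (γ t).1 j) s, fun j => deriv (fun t => (γ t).2.1 j) s),
    zero_le_one, ?_, ?_, ?_, ?_⟩
  · refine IntegrableOn.of_bound (by simp) ?_ M ?_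
    · refine Measurable.aestronglyMeasurable ?_
      exact (measurable_pi_lambda _ fun j => measurable_deriv _).prodMk
        (measurable_pi_lambda _ fun j => measurable_deriv _)
    · refine Filter.Eventually.of_forall fun s => ?_
      rw [Prod.norm_def]
      refine max_le ?_ ?_
      · refine (pi_norm_le_iff_of_nonneg hM0).2 fun j => ?_
        have := norm_deriv_le_of_lipschitz (x₀ := s) (hLa j)
        rwa [Real.coe_toNNReal _ hM0] at this
      · refine (pi_norm_le_iff_of_nonneg hM0).2 fun j => ?_
        have := norm_deriv_le_of_lipschitz (x₀ := s) (hLb j)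
        rwa [Real.coe_toNNReal _ hM0] at this
  · intro t _ j
    have := ((hLa j).lipschitzOnWith (s := Set.uIcc 0 t)).absolutelyContinuousOnInterval.integral_deriv_eq_sub
    simp only at this ⊢
    rw [this]; ring
  · intro t _ j
    have := ((hLb j).lipschitzOnWith (s := Set.uIcc 0 t)).absolutelyContinuousOnInterval.integral_deriv_eq_sub
    simp only at this ⊢
    rw [this]; ring
  · intro t ht
    have hsub : Set.uIcc 0 t ⊆ Set.Icc (0 : ℝ) 1 := by
      rw [Set.uIcc_of_le ht.1]
      exact Set.Icc_subset_Icc le_rfl ht.2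
    have h1 := (hLy.mono hsub).absolutelyContinuousOnInterval.integral_deriv_eq_sub
    have h2 : ∀ᵐ s : ℝ, ∀ j, DifferentiableAt ℝ (fun t => (γ t).1 j) s ∧
        DifferentiableAt ℝ (fun t => (γ t).2.1 j) s := by
      rw [ae_all_iff]
      intro j
      filter_upwards [(hLa j).ae_differentiableAt_real, (hLb j).ae_differentiableAt_real]
        with s h h'
      exact ⟨h, h'⟩
    have h3 : ∀ᵐ s : ℝ, deriv (fun t => (γ t).2.2) s = (1 / 2) * ∑ j,
        (deriv (fun t => (γ t).2.1 j) s * (γ s).1 j -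
          deriv (fun t => (γ t).1 j) s * (γ s).2.1 j) := by
      filter_upwards [h2] with s hs
      apply HasDerivAt.deriv
      have hW : HasDerivAt (fun t => W s t) ((1 / 2) * ∑ j,
          (deriv (fun t => (γ t).2.1 j) s * (γ s).1 j -
            deriv (fun t => (γ t).1 j) s * (γ s).2.1 j)) s := by
        refine HasDerivAt.const_mul _ (HasDerivAt.fun_sum fun j _ => ?_)
        exact (((hs j).2.hasDerivAt.sub_const _).mul_const _).sub
          (((hs j).1.hasDerivAt.sub_const _).mul_const _)
      have hR : HasDerivAt (fun t => (γ t).2.2 - (γ s).2.2 - W s t) 0 s := by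
        have hO : (fun t => (γ t).2.2 - (γ s).2.2 - W s t) =O[𝓝 s] fun t => ‖t - s‖ ^ 2 := by
          refine Asymptotics.IsBigO.of_bound (M ^ 2) (Filter.Eventually.of_forall fun t => ?_)
          have := hy s t
          have e : ‖‖t - s‖ ^ 2‖ = (s - t) ^ 2 := by
            rw [norm_pow, norm_norm, Real.norm_eq_abs, sq_abs]
            ring
          rw [e]
          exact this
        have := (hO.hasFDerivAt (𝕜 := ℝ) (by norm_num)).hasDerivAt
        simpa using this
      have hsum := (hR.add hW).add_const (γ s).2.2
      rw [zero_add] at hsum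
      refine hsum.congr_of_eventuallyEq (Filter.Eventually.of_forall fun t => ?_)
      simp only [Pi.add_apply]
      ring
    have h4 : ∫ s in (0 : ℝ)..t, (1 / 2) * ∑ j,
        (deriv (fun t => (γ t).2.1 j) s * (γ s).1 j -
          deriv (fun t => (γ t).1 j) s * (γ s).2.1 j) = (γ t).2.2 - (γ 0).2.2 := by
      rw [← h1]
      refine intervalIntegral.integral_congr_ae ?_
      filter_upwards [h3] with s hs _
      exact hs.symm
    simp only at h4 ⊢
    rw [h4]
    ring

theorem exists_limit_curve [NeZero n] (hd : IsLIHomDist d) {Γ : Set (Pt n)} (hΓ : IsClosed Γ)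
    (x y : Pt n) (K : ℝ) (hK : 0 ≤ K)
    (hch : ∀ N : ℕ, 0 < N → Reach d Γ (K / N) (6 * N) x y) :
    ∃ γ : ℝ → Pt n, γ 0 = x ∧ γ 1 = y ∧ (∀ t, γ t ∈ Γ) ∧
      ∀ s t, d (γ s) (γ t) ≤ 6 * K * |s - t| := by
  obtain ⟨C₂, hC₂, hlo⟩ := exists_lower hd
  choose g hg0 hg1 hgΓ hgd using fun N : ℕ => hch (N + 1) (Nat.succ_pos N)
  let cl : ℝ → ℝ := fun t => (Set.projIcc (0 : ℝ) 1 zero_le_one t : ℝ)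
  have hcl : ∀ t, cl t ∈ Set.Icc (0 : ℝ) 1 := fun t => (Set.projIcc (0 : ℝ) 1 zero_le_one t).2
  have hclL : ∀ s t, |cl s - cl t| ≤ |s - t| := fun s t => Set.abs_projIcc_sub_projIcc _
  let idx : ℕ → ℝ → ℕ := fun N t => ⌊cl t * ((6 * (N + 1) : ℕ) : ℝ)⌋₊
  have hidx : ∀ N t, idx N t ≤ 6 * (N + 1) := by
    intro N t
    refine Nat.floor_le_of_le ?_
    exact mul_le_of_le_one_left (by positivity) (hcl t).2
  have hKN : ∀ N : ℕ, (0 : ℝ) < ((N + 1 : ℕ) : ℝ) := fun N => by positivity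
  have hdist : ∀ N s t, idx N s ≤ idx N t →
      d (g N (idx N s)) (g N (idx N t)) ≤ 6 * K * |s - t| + K / ((N + 1 : ℕ) : ℝ) := by
    intro N s t hst
    have h1 := chain_dist hd (hgd N) (idx N s) (idx N t - idx N s) (by
      have := hidx N t; omega)
    rw [Nat.add_sub_cancel' hst, Nat.cast_sub hst] at h1
    refine h1.trans ?_
    have h2 : (idx N t : ℝ) ≤ cl t * ((6 * (N + 1) : ℕ) : ℝ) :=
      Nat.floor_le (mul_nonneg (hcl t).1 (by positivity))
    have h3 : cl s * ((6 * (N + 1) : ℕ) : ℝ) < idx N s + 1 := Nat.lt_floor_add_one _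
    have h4 : cl t - cl s ≤ |s - t| := by
      refine le_trans ?_ (hclL s t)
      rw [abs_sub_comm]
      exact le_abs_self _
    have h5 : (idx N t : ℝ) - idx N s ≤ |s - t| * (6 * ((N + 1 : ℕ) : ℝ)) + 1 := by
      have h6 := mul_le_mul_of_nonneg_right h4 (by positivity : (0 : ℝ) ≤ ((6 * (N + 1) : ℕ) : ℝ))
      have h7 : ((6 * (N + 1) : ℕ) : ℝ) = 6 * ((N + 1 : ℕ) : ℝ) := by push_cast; ring
      rw [h7] at h2 h3 h6
      linarith
    have h6 := mul_le_mul_of_nonneg_left h5 (div_nonneg hK (hKN N).le)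
    refine h6.trans (le_of_eq ?_)
    have := (hKN N).ne'
    field_simp
  have hdist' : ∀ N s t,
      d (g N (idx N s)) (g N (idx N t)) ≤ 6 * K * |s - t| + K / ((N + 1 : ℕ) : ℝ) := by
    intro N s t
    rcases le_total (idx N s) (idx N t) with h | h
    · exact hdist N s t h
    · rw [hd.symm, abs_sub_comm]; exact hdist N t s h
  let S : Set (Pt n) := (fun p => mul x p) '' {p : Pt n | hom p ≤ C₂ * (6 * K)}
  have hS : IsCompact S := (hom_le_compact _).image
    (mul_continuous.comp (continuous_const.prodMk continuous_id))
  have hmem : ∀ N t, g N (idx N t) ∈ S := by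
    intro N t
    refine ⟨mul (inv x) (g N (idx N t)), ?_, mul_inv_cancel _ _⟩
    refine (hlo _).trans (mul_le_mul_of_nonneg_left ?_ hC₂.le)
    rw [← hd.eq_norm]
    have h1 := chain_dist hd (hgd N) 0 (idx N t) (by have := hidx N t; omega)
    rw [zero_add, hg0] at h1
    refine h1.trans ?_
    have h2 : (idx N t : ℝ) ≤ 6 * ((N + 1 : ℕ) : ℝ) := by exact_mod_cast hidx N t
    refine (mul_le_mul_of_nonneg_left h2 (div_nonneg hK (hKN N).le)).trans (le_of_eq ?_)
    have := (hKN N).ne'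
    field_simp
  let U : Ultrafilter ℕ := Filter.hyperfilter ℕ
  have hU : (U : Filter ℕ) ≤ Filter.atTop := Nat.hyperfilter_le_atTop
  have hlim : ∀ t, ∃ q, Filter.Tendsto (fun N => g N (idx N t)) U (𝓝 q) := by
    intro t
    obtain ⟨q, _, hq⟩ := hS.ultrafilter_le_nhds (U.map fun N => g N (idx N t)) (by
      rw [Filter.le_principal_iff]
      exact Filter.mem_map.2 (Filter.univ_mem' fun N => hmem N t))
    exact ⟨q, hq⟩
  choose γ hγ using hlim
  refine ⟨γ, ?_, ?_, ?_, ?_⟩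
  · refine tendsto_nhds_unique (hγ 0) ?_
    have : (fun N => g N (idx N 0)) = fun _ => x := by
      funext N
      have : idx N 0 = 0 := by simp [idx, cl]
      rw [this, hg0]
    rw [this]
    exact tendsto_const_nhds
  · refine tendsto_nhds_unique (hγ 1) ?_
    have : (fun N => g N (idx N 1)) = fun _ => y := by
      funext N
      have : idx N 1 = 6 * (N + 1) := by
        have hc : cl 1 = 1 := by simp [cl]
        simp only [idx, hc, one_mul, Nat.floor_natCast]
      rw [this, hg1]
    rw [this]
    exact tendsto_const_nhds
  · intro t
    exact hΓ.mem_of_tendsto (hγ t) (Filter.Eventually.of_forall fun N => hgΓ N _ (hidx N t))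
  · intro s t
    have h1 : Filter.Tendsto (fun N => d (g N (idx N s)) (g N (idx N t))) U
        (𝓝 (d (γ s) (γ t))) :=
      ((dist_continuous hd).tendsto (γ s, γ t)).comp ((hγ s).prodMk_nhds (hγ t))
    have h2 : Filter.Tendsto (fun N : ℕ => 6 * K * |s - t| + K / ((N + 1 : ℕ) : ℝ)) U
        (𝓝 (6 * K * |s - t| + 0)) := by
      refine Filter.Tendsto.mono_left ?_ hU
      refine tendsto_const_nhds.add ?_
      exact (tendsto_const_div_atTop_nhds_zero_nat K).comp (Filter.tendsto_add_atTop_nat 1)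
    rw [add_zero] at h2
    exact le_of_tendsto_of_tendsto' h1 h2 fun N => hdist' N s t

theorem pathLength_le (γ : ℝ → Pt n) (K : ℝ)
    (hγ : ∀ s t, d (γ s) (γ t) ≤ K * |s - t|) : pathLength d γ 0 1 ≤ ENNReal.ofReal K := by
  unfold pathLength
  refine iSup_le fun N => iSup_le fun σ => iSup_le fun hσ => ENNReal.ofReal_le_ofReal ?_
  have h1 : ∀ i ∈ Finset.range N, d (γ (σ i)) (γ (σ (i + 1))) ≤ K * (σ (i + 1) - σ i) := by
    intro i _
    refine (hγ _ _).trans (le_of_eq ?_)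
    rw [abs_sub_comm, abs_of_nonneg (sub_nonneg.2 (hσ.1 (Nat.le_succ i)))]
  refine (Finset.sum_le_sum h1).trans (le_of_eq ?_)
  rw [← Finset.mul_sum, Finset.sum_range_sub, hσ.2.1, hσ.2.2]
  ring

theorem le_pathLength (γ : ℝ → Pt n) :
    ENNReal.ofReal (d (γ 0) (γ 1)) ≤ pathLength d γ 0 1 := by
  unfold pathLength
  refine le_iSup_of_le 1 (le_iSup_of_le (fun i => if i = 0 then 0 else 1) (le_iSup_of_le ?_ ?_))
  · refine ⟨?_, by simp, by simp⟩
    intro i j hij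
    show (if i = 0 then (0 : ℝ) else 1) ≤ if j = 0 then 0 else 1
    split_ifs with h1 h2
    · exact le_rfl
    · exact zero_le_one
    · omega
    · exact le_rfl
  · simp

end curves

/-- in `ℍⁿ`, `n ≥ 2`, with a left-invariant homogeneous distance `d`, the
restriction of `d` to the intrinsic graph `Γ` of an intrinsic `L`-Lipschitz function
`φ̃ : 𝕎 → 𝕃` is bi-Lipschitz equivalent to the intrinsic length distance `d^Γ`. -/
theorem stmt14 {n : ℕ} [NeZero n] (hn : 2 ≤ n)
    (d : Pt n → Pt n → ℝ) (hd : IsLIHomDist d)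
    (L : ℝ) (hL : 0 < L) (φv : Pt n → ℝ) (hφ : IsIntrinsicLip d L φv) :
    ∃ C : ℝ≥0∞, 1 ≤ C ∧ C ≠ ⊤ ∧
      ∀ x ∈ graphSet φv, ∀ y ∈ graphSet φv,
        ENNReal.ofReal (d x y) ≤ C * dGamma d (graphSet φv) x y ∧
        dGamma d (graphSet φv) x y ≤ C * ENNReal.ofReal (d x y) := by
  obtain ⟨K, hK, hch⟩ := exists_chain hn hd hL hφ
  have hcl := graph_closed hd hL hφ
  refine ⟨ENNReal.ofReal (1 + 6 * K), ?_, ENNReal.ofReal_ne_top, fun x hx y hy => ⟨?_, ?_⟩⟩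
  · rw [ENNReal.one_le_ofReal]
    linarith
  · have h1 : (1 : ℝ≥0∞) ≤ ENNReal.ofReal (1 + 6 * K) := by
      rw [ENNReal.one_le_ofReal]
      linarith
    have h2 : ENNReal.ofReal (d x y) ≤ dGamma d (graphSet φv) x y := by
      unfold dGamma
      refine le_iInf fun γ => le_iInf fun hγ => ?_
      obtain ⟨_, _, rfl, rfl⟩ := hγ
      exact le_pathLength γ
    calc ENNReal.ofReal (d x y) ≤ 1 * dGamma d (graphSet φv) x y := by rwa [one_mul]
      _ ≤ _ := mul_le_mul_left h1 _
  · have hD := hd.nonneg x y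
    obtain ⟨γ, h0, h1, hΓ, hlip⟩ := exists_limit_curve hd hcl x y (K * d x y) (by positivity)
      (hch x hx y hy)
    have hc := exists_hcurve hd γ (6 * (K * d x y)) (by positivity) hlip
    have h2 : dGamma d (graphSet φv) x y ≤ pathLength d γ 0 1 := by
      unfold dGamma
      exact iInf₂_le γ ⟨hc, fun t _ => hΓ t, h0, h1⟩
    refine (h2.trans (pathLength_le γ _ hlip)).trans ?_
    rw [← ENNReal.ofReal_mul (by positivity)]
    refine ENNReal.ofReal_le_ofReal ?_
    nlinarith

end Heis
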